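/- arXiv:0810.3590 — 2 statements merged into one kernel-verified Lean document; each statement's English description precedes it below -/
import Mathlib

section
/- For every p ≥ 1, the sum defining B_p in the discrete stability condition is direct: curl 𝒫_p⁰(K) ∩ {∇(div a) : a ∈ RT_p⁰(K)} = {0}. Equivalently, if φ ∈ 𝒫_p⁰(K) and a ∈ RT_p⁰(K) satisfy curl φ = ∇(div a), then curl φ = ∇(div a) = 0. -/
open MeasureTheory

noncomputable section

/-- The open unit square `K = (0,1)²`. -/
def Ksq : Set (ℝ × ℝ) := Set.Ioo 0 1 ×ˢ Set.Ioo 0 1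

/-- `f` is (the function of) a polynomial of degree `≤ p₁` in `ξ₁` and `≤ p₂` in `ξ₂`,
i.e. `f ∈ 𝒫_{p₁,p₂}(K)`. -/
def IsPoly2 (p₁ p₂ : ℕ) (f : ℝ × ℝ → ℂ) : Prop :=
  ∃ c : Fin (p₁ + 1) → Fin (p₂ + 1) → ℂ,
    ∀ x : ℝ × ℝ, f x = ∑ i, ∑ j, c i j * (x.1 : ℂ) ^ (i : ℕ) * (x.2 : ℂ) ^ (j : ℕ)

/-- `f ∈ 𝒫_p⁰(K)`: polynomial of degree `≤ p` in each variable, vanishing on `∂K`. -/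
def MemP0 (p : ℕ) (f : ℝ × ℝ → ℂ) : Prop :=
  IsPoly2 p p f ∧ ∀ t ∈ Set.Icc (0 : ℝ) 1,
    f (t, 0) = 0 ∧ f (t, 1) = 0 ∧ f (0, t) = 0 ∧ f (1, t) = 0

/-- `v ∈ RT_p(K) = 𝒫_{p,p-1}(K) × 𝒫_{p-1,p}(K)`. -/
def MemRT (p : ℕ) (v : ℝ × ℝ → ℂ × ℂ) : Prop :=
  IsPoly2 p (p - 1) (fun x => (v x).1) ∧ IsPoly2 (p - 1) p (fun x => (v x).2)

/-- `v ∈ RT_p⁰(K)`: Raviart–Thomas field with vanishing normal trace `v·n = 0` on `∂K`. -/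
def MemRT0 (p : ℕ) (v : ℝ × ℝ → ℂ × ℂ) : Prop :=
  MemRT p v ∧ ∀ t ∈ Set.Icc (0 : ℝ) 1,
    (v (0, t)).1 = 0 ∧ (v (1, t)).1 = 0 ∧ (v (t, 0)).2 = 0 ∧ (v (t, 1)).2 = 0

/-- partial derivative `∂f/∂ξ₁`. -/
def pd1 (f : ℝ × ℝ → ℂ) (x : ℝ × ℝ) : ℂ := fderiv ℝ f x (1, 0)

/-- partial derivative `∂f/∂ξ₂`. -/
def pd2 (f : ℝ × ℝ → ℂ) (x : ℝ × ℝ) : ℂ := fderiv ℝ f x (0, 1)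

/-- divergence of a 2D vector field. -/
def vdiv (v : ℝ × ℝ → ℂ × ℂ) (x : ℝ × ℝ) : ℂ :=
  pd1 (fun y => (v y).1) x + pd2 (fun y => (v y).2) x

/-- vector curl of a scalar function: `curl φ = (∂φ/∂ξ₂, −∂φ/∂ξ₁)`. -/
def scurl (f : ℝ × ℝ → ℂ) (x : ℝ × ℝ) : ℂ × ℂ := (pd2 f x, -pd1 f x)

/-- gradient of a scalar function. -/
def sgrad (f : ℝ × ℝ → ℂ) (x : ℝ × ℝ) : ℂ × ℂ := (pd1 f x, pd2 f x)

/-- `L²(K)` inner product of scalar functions. -/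
def ip0 (f g : ℝ × ℝ → ℂ) : ℂ := ∫ x in Ksq, f x * starRingEnd ℂ (g x)

/-- `L²(K)` inner product of vector fields. -/
def ip2 (u v : ℝ × ℝ → ℂ × ℂ) : ℂ :=
  ∫ x in Ksq, ((u x).1 * starRingEnd ℂ ((v x).1) + (u x).2 * starRingEnd ℂ ((v x).2))

/-- `L²(K)` norm of a scalar function. -/
def nrm0 (f : ℝ × ℝ → ℂ) : ℝ := Real.sqrt (∫ x in Ksq, ‖f x‖ ^ 2)

/-- `L²(K)` norm of a vector field. -/
def nrm2 (u : ℝ × ℝ → ℂ × ℂ) : ℝ :=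
  Real.sqrt (∫ x in Ksq, (‖(u x).1‖ ^ 2 + ‖(u x).2‖ ^ 2))

open Complex in
/-- If `(ψ, φ)` satisfies the Cauchy-Riemann equations on the unit square and `φ` vanishes on the
boundary, then every real linear functional of `φ` is nonpositive there (maximum principle). -/
theorem clm_apply_nonpos_of_scurl_eq_sgrad {φ ψ : ℝ × ℝ → ℂ}
    (hφ : Differentiable ℝ φ) (hψ : Differentiable ℝ ψ)
    (hbd : ∀ t ∈ Set.Icc (0 : ℝ) 1,
      φ (t, 0) = 0 ∧ φ (t, 1) = 0 ∧ φ (0, t) = 0 ∧ φ (1, t) = 0)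
    (h : ∀ x ∈ Ksq, scurl φ x = sgrad ψ x) (L : ℂ →L[ℝ] ℝ) {x : ℝ × ℝ} (hx : x ∈ Ksq) :
    L (φ x) ≤ 0 := by
  set G : ℂ → ℂ := fun z => L (ψ (equivRealProdCLM z)) + I * L (φ (equivRealProdCLM z)) with hG
  have hder (z : ℂ) : HasFDerivAt G
      (ofRealCLM ∘L L ∘L fderiv ℝ ψ (equivRealProdCLM z) ∘L (equivRealProdCLM : ℂ →L[ℝ] ℝ × ℝ) +
        I • (ofRealCLM ∘L L ∘L fderiv ℝ φ (equivRealProdCLM z) ∘L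
          (equivRealProdCLM : ℂ →L[ℝ] ℝ × ℝ))) z := by
    have key {f : ℝ × ℝ → ℂ} (hf : Differentiable ℝ f) :=
      (ofRealCLM.hasFDerivAt.comp z (L.hasFDerivAt.comp z
        ((hf (equivRealProdCLM z)).hasFDerivAt.comp z equivRealProdCLM.hasFDerivAt)))
    exact (key hψ).add ((key hφ).const_mul I)
  have hGd : Differentiable ℝ G := fun z => (hder z).differentiableAt
  have hhol : DiffContOnCl ℂ (fun z => exp (-I * G z)) (Set.Ioo 0 1 ×ℂ Set.Ioo 0 1) := by
    refine ⟨fun z hz => ?_, by have := hGd.continuous; fun_prop⟩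
    have hz' : equivRealProdCLM z ∈ Ksq := hz
    have hCR := h (z.re, z.im) hz'
    simp only [scurl, sgrad, Prod.mk.injEq, pd1, pd2] at hCR
    have : DifferentiableAt ℂ G z := by
      refine differentiableAt_complex_iff_differentiableAt_real.2 ⟨hGd z, ?_⟩
      rw [(hder z).fderiv]
      simp [← hCR.1, ← hCR.2, mul_add, ← mul_assoc, map_neg L]
      ring
    exact ((this.const_mul (-I)).cexp).differentiableWithinAt
  have hnorm (z : ℂ) : ‖exp (-I * G z)‖ = Real.exp (L (φ (equivRealProdCLM z))) := by
    simp [norm_exp, hG]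
  have hmax := norm_le_of_forall_mem_frontier_norm_le (C := 1)
    ((Metric.isBounded_Ioo 0 1).reProdIm (Metric.isBounded_Ioo 0 1)) hhol (fun z hz => ?_)
    (subset_closure (show equivRealProdCLM.symm x ∈ Set.Ioo 0 1 ×ℂ Set.Ioo 0 1 from by
      simpa [mem_reProdIm, Ksq] using hx))
  · rw [hnorm, Real.exp_le_one_iff] at hmax
    simpa using hmax
  · have hz0 : φ (z.re, z.im) = 0 := by
      rw [frontier_reProdIm, closure_Ioo zero_ne_one, frontier_Ioo zero_lt_one] at hz
      rcases hz with ⟨hr, hi⟩ | ⟨hr, hi⟩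
      · rcases hi with hi | hi
        · rw [show z.im = 0 from hi]; exact (hbd _ hr).1
        · rw [show z.im = 1 from hi]; exact (hbd _ hr).2.1
      · rcases hr with hr | hr
        · rw [show z.re = 0 from hr]; exact (hbd _ hi).2.2.1
        · rw [show z.re = 1 from hr]; exact (hbd _ hi).2.2.2
    rw [hnorm, show equivRealProdCLM z = (z.re, z.im) from rfl, hz0]
    simp

/-- If `curl φ = ∇ψ` on the unit square and `φ` vanishes on the boundary, then `φ = 0`. -/
theorem eq_zero_of_scurl_eq_sgrad {φ ψ : ℝ × ℝ → ℂ}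
    (hφ : Differentiable ℝ φ) (hψ : Differentiable ℝ ψ)
    (hbd : ∀ t ∈ Set.Icc (0 : ℝ) 1,
      φ (t, 0) = 0 ∧ φ (t, 1) = 0 ∧ φ (0, t) = 0 ∧ φ (1, t) = 0)
    (h : ∀ x ∈ Ksq, scurl φ x = sgrad ψ x) {x : ℝ × ℝ} (hx : x ∈ Ksq) : φ x = 0 := by
  have key (L : ℂ →L[ℝ] ℝ) : L (φ x) = 0 := by
    refine le_antisymm (clm_apply_nonpos_of_scurl_eq_sgrad hφ hψ hbd h L hx) ?_
    simpa using clm_apply_nonpos_of_scurl_eq_sgrad hφ hψ hbd h (-L) hx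
  exact Complex.ext (key Complex.reCLM) (key Complex.imCLM)

open scoped ContDiff in
theorem IsPoly2.contDiff {p₁ p₂ : ℕ} {f : ℝ × ℝ → ℂ} (hf : IsPoly2 p₁ p₂ f) :
    ContDiff ℝ ∞ f := by
  obtain ⟨c, hc⟩ := hf
  rw [funext hc]
  have h₁ : ContDiff ℝ ∞ (fun x : ℝ × ℝ => (x.1 : ℂ)) := Complex.ofRealCLM.contDiff.comp contDiff_fst
  have h₂ : ContDiff ℝ ∞ (fun x : ℝ × ℝ => (x.2 : ℂ)) := Complex.ofRealCLM.contDiff.comp contDiff_snd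
  fun_prop

theorem MemRT.differentiable_vdiv {p : ℕ} {a : ℝ × ℝ → ℂ × ℂ} (ha : MemRT p a) :
    Differentiable ℝ (vdiv a) := by
  have key {f : ℝ × ℝ → ℂ} {m n : ℕ} (hf : IsPoly2 m n f) (v : ℝ × ℝ) :
      Differentiable ℝ (fun x => fderiv ℝ f x v) :=
    ((hf.contDiff.fderiv_right (m := 1) (by norm_cast)).differentiable one_ne_zero).clm_apply
      (differentiable_const v)
  exact (key ha.1 (1, 0)).add (key ha.2 (0, 1))

/-- The sum `B_p = curl 𝒫_p⁰(K) + ∇ div RT_p⁰(K)` is direct: if `φ ∈ 𝒫_p⁰(K)` and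
`a ∈ RT_p⁰(K)` satisfy `curl φ = ∇(div a)` on `K`, then `curl φ = ∇(div a) = 0` on `K`. -/
theorem Bp_sum_direct (p : ℕ) (hp : 1 ≤ p) (φ : ℝ × ℝ → ℂ) (a : ℝ × ℝ → ℂ × ℂ)
    (hφ : MemP0 p φ) (ha : MemRT0 p a)
    (h : ∀ x ∈ Ksq, scurl φ x = sgrad (vdiv a) x) :
    ∀ x ∈ Ksq, scurl φ x = 0 ∧ sgrad (vdiv a) x = 0 := by
  intro x hx
  have hopen : IsOpen Ksq := isOpen_Ioo.prod isOpen_Ioo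
  have hzero : φ =ᶠ[nhds x] fun _ => 0 := by
    filter_upwards [hopen.mem_nhds hx] with y hy
    exact eq_zero_of_scurl_eq_sgrad (hφ.1.contDiff.differentiable (by simp))
      ha.1.differentiable_vdiv hφ.2 h hy
  have hcurl : scurl φ x = 0 := by
    simp [scurl, pd1, pd2, hzero.fderiv_eq]
  exact ⟨hcurl, h x hx ▸ hcurl⟩
end
end

section
/- (Best L²-approximation of bubble fields by Raviart–Thomas bubbles, case r = 1.) There exists a constant C > 0 independent of p such that for every p ≥ 1 and every vector field u ∈ C¹(K̄, ℂ²) with u·n = 0 on ∂K there holds inf_{q ∈ RT_p⁰(K)} ‖u − q‖_{0,K} ≤ C p^{−1} (‖u‖²_{0,K} + ‖Du‖²_{0,K})^{1/2}, where Du denotes the derivative of u. -/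
open MeasureTheory

noncomputable section

open Polynomial in
/-- Integration over `[0, 1]`, as a linear functional on real polynomials. -/
def unitIntegral : ℝ[X] →ₗ[ℝ] ℝ where
  toFun p := ∫ x in (0 : ℝ)..1, p.eval x
  map_add' p q := by
    simp only [eval_add]
    exact intervalIntegral.integral_add (p.continuous.intervalIntegrable _ _)
      (q.continuous.intervalIntegrable _ _)
  map_smul' c p := by simp

namespace UnitLegendre

open Polynomial

lemma unitIntegral_apply (p : ℝ[X]) : unitIntegral p = ∫ x in (0 : ℝ)..1, p.eval x := rfl

lemma unitIntegral_C_mul (a : ℝ) (p : ℝ[X]) : unitIntegral (C a * p) = a * unitIntegral p := by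
  rw [← smul_eq_C_mul, map_smul, smul_eq_mul]

lemma unitIntegral_derivative (p : ℝ[X]) :
    unitIntegral (derivative p) = p.eval 1 - p.eval 0 :=
  intervalIntegral.integral_eq_sub_of_hasDerivAt (fun x _ => p.hasDerivAt x)
    ((derivative p).continuous.intervalIntegrable _ _)

lemma unitIntegral_mul_self_nonneg (p : ℝ[X]) : 0 ≤ unitIntegral (p * p) :=
  intervalIntegral.integral_nonneg zero_le_one fun x _ => by
    rw [eval_mul]; exact mul_self_nonneg _

lemma unitIntegral_mul_self_pos {p : ℝ[X]} (hp : p ≠ 0) : 0 < unitIntegral (p * p) := by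
  refine intervalIntegral.integral_pos zero_lt_one (p * p).continuous.continuousOn
    (fun x _ => by rw [eval_mul]; exact mul_self_nonneg _) ?_
  by_contra! h
  refine hp (eq_zero_of_infinite_isRoot p ((Set.Icc_infinite (zero_lt_one' ℝ)).mono ?_))
  intro x hx
  have := h x hx
  rw [eval_mul] at this
  exact mul_self_eq_zero.1 (le_antisymm this (mul_self_nonneg _))

/-- The weight `x (1 - x)` of the Legendre operator on `[0, 1]`. -/
abbrev wt : ℝ[X] := X * (1 - X)

/-- The Legendre operator, taking `q` to the derivative of `x (1 - x)` times that of `q`. -/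
abbrev op (q : ℝ[X]) : ℝ[X] := derivative (wt * derivative q)

lemma energy_eq (p q : ℝ[X]) :
    unitIntegral (wt * derivative p * derivative q) = -unitIntegral (p * op q) := by
  have h := unitIntegral_derivative (p * (wt * derivative q))
  rw [derivative_mul, map_add] at h
  have h' : derivative p * (wt * derivative q) = wt * derivative p * derivative q := by ring
  rw [h'] at h
  simp only [eval_mul, eval_X, eval_sub, eval_one, sub_self, mul_zero, zero_mul] at h
  linarith

lemma energy_self_nonneg (p : ℝ[X]) :
    0 ≤ unitIntegral (wt * derivative p * derivative p) :=
  intervalIntegral.integral_nonneg zero_le_one fun x hx => by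
    simp only [eval_mul, eval_X, eval_sub, eval_one]
    rw [mul_assoc]
    exact mul_nonneg (mul_nonneg hx.1 (by linarith [hx.2])) (mul_self_nonneg _)

lemma energy_self_le (p : ℝ[X]) :
    unitIntegral (wt * derivative p * derivative p) ≤
      unitIntegral (derivative p * derivative p) := by
  refine intervalIntegral.integral_mono_on zero_le_one
    ((Polynomial.continuous _).intervalIntegrable _ _)
    ((Polynomial.continuous _).intervalIntegrable _ _) fun x hx => ?_
  simp only [eval_mul, eval_X, eval_sub, eval_one]
  nlinarith [mul_self_nonneg (eval x (derivative p)),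
    mul_nonneg (mul_self_nonneg (eval x (derivative p)))
      (by nlinarith [hx.1, hx.2] : 0 ≤ 1 - x * (1 - x))]

lemma coeff_op (q : ℝ[X]) (m : ℕ) :
    (op q).coeff m = (m + 1) * ((m + 1) * q.coeff (m + 1) - m * q.coeff m) := by
  have h : wt * derivative q = X * derivative q - X * (X * derivative q) := by ring
  rw [op, coeff_derivative, h, coeff_sub, coeff_X_mul, coeff_X_mul, coeff_derivative]
  rcases m with _ | m
  · simp
  · rw [coeff_X_mul, coeff_derivative]; push_cast; ring

lemma degree_op_lt {q : ℝ[X]} {n : ℕ} (hq : q.degree < n) : (op q).degree < n := by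
  rw [degree_lt_iff_coeff_zero] at hq ⊢
  intro m hm
  rw [coeff_op, hq m hm, hq (m + 1) (by omega)]
  simp

lemma exists_monic_orthogonal (n : ℕ) : ∃ L : ℝ[X], L.Monic ∧ L.degree = n ∧
    ∀ q : ℝ[X], q.degree < n → unitIntegral (L * q) = 0 := by
  let B : ℝ[X] →ₗ[ℝ] ℝ[X] →ₗ[ℝ] ℝ := (LinearMap.mul ℝ ℝ[X]).compr₂ unitIntegral
  let T : degreeLT ℝ n →ₗ[ℝ] Module.Dual ℝ (degreeLT ℝ n) := B.domRestrict₁₂ _ _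
  have hTa : ∀ p q, T p q = unitIntegral (p.1 * q.1) := fun _ _ => rfl
  have : FiniteDimensional ℝ (degreeLT ℝ n) :=
    Module.Finite.equiv (degreeLTEquiv ℝ n).symm
  have hT : Function.Injective T := by
    rw [injective_iff_map_eq_zero]
    intro p hp
    by_contra h
    refine (unitIntegral_mul_self_pos fun h' => h (Subtype.ext h')).ne' ?_
    rw [← hTa, hp, LinearMap.zero_apply]
  obtain ⟨a, ha⟩ := (LinearMap.injective_iff_surjective_of_finrank_eq_finrank
    Subspace.dual_finrank_eq.symm).1 hT ((B (X ^ n)).comp (degreeLT ℝ n).subtype)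
  have had := mem_degreeLT.1 a.2
  refine ⟨X ^ n - a.1, monic_X_pow_sub had, ?_, fun q hq => ?_⟩
  · rw [degree_sub_eq_left_of_degree_lt (by rwa [degree_X_pow]), degree_X_pow]
  · have h : unitIntegral (a.1 * q) = unitIntegral (X ^ n * q) := by
      rw [← hTa a ⟨q, mem_degreeLT.2 hq⟩, ha]
      rfl
    rw [sub_mul, map_sub, h, sub_self]

/-- The monic orthogonal polynomials on `[0, 1]`. -/
def leg (n : ℕ) : ℝ[X] := (exists_monic_orthogonal n).choose

lemma leg_monic (n : ℕ) : (leg n).Monic := (exists_monic_orthogonal n).choose_spec.1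

lemma degree_leg (n : ℕ) : (leg n).degree = n := (exists_monic_orthogonal n).choose_spec.2.1

lemma natDegree_leg (n : ℕ) : (leg n).natDegree = n :=
  natDegree_eq_of_degree_eq_some (degree_leg n)

lemma unitIntegral_leg_mul {n : ℕ} {q : ℝ[X]} (hq : q.degree < n) :
    unitIntegral (leg n * q) = 0 := (exists_monic_orthogonal n).choose_spec.2.2 q hq

lemma leg_zero : leg 0 = 1 := (leg_monic 0).natDegree_eq_zero.1 (natDegree_leg 0)

/-- The squared norm of `leg n`. -/
def legNorm (n : ℕ) : ℝ := unitIntegral (leg n * leg n)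

lemma legNorm_pos (n : ℕ) : 0 < legNorm n := unitIntegral_mul_self_pos (leg_monic n).ne_zero

lemma unitIntegral_leg_mul_leg {m n : ℕ} (h : m ≠ n) : unitIntegral (leg m * leg n) = 0 := by
  rcases h.lt_or_gt with h | h
  · rw [mul_comm]; exact unitIntegral_leg_mul (by rw [degree_leg]; exact_mod_cast h)
  · exact unitIntegral_leg_mul (by rw [degree_leg]; exact_mod_cast h)

lemma degree_sub_leg_lt {q : ℝ[X]} {m : ℕ} (hq : q.degree < (m + 1 : ℕ)) :
    (q - C (q.coeff m) * leg m).degree < m := by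
  rw [degree_lt_iff_coeff_zero] at hq ⊢
  intro k hk
  rw [coeff_sub, coeff_C_mul]
  rcases hk.eq_or_lt with rfl | hk
  · have := (leg_monic m).coeff_natDegree
    rw [natDegree_leg] at this
    rw [this]; ring
  · rw [hq k hk, coeff_eq_zero_of_natDegree_lt (p := leg m) (by rwa [natDegree_leg])]; ring

/-- Induction along the expansion in the polynomials `leg m`, in bounded degree. -/
lemma leg_induction_of_degree_lt {P : ℝ[X] → Prop} {n : ℕ} (h0 : P 0)
    (hadd : ∀ (a : ℝ) (m : ℕ) (q : ℝ[X]), m < n → q.degree < m → P q → P (C a * leg m + q))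
    (q : ℝ[X]) (hq : q.degree < n) : P q := by
  induction n generalizing q with
  | zero =>
    have : q = 0 := degree_eq_bot.1 (Nat.WithBot.lt_zero_iff.1 (by exact_mod_cast hq))
    rwa [this]
  | succ m ih =>
    have h := degree_sub_leg_lt hq
    simpa using hadd (q.coeff m) m _ m.lt_succ_self h
      (ih (fun a k r hk => hadd a k r (hk.trans m.lt_succ_self)) _ h)

/-- Induction along the expansion in the polynomials `leg m`. -/
lemma leg_induction {P : ℝ[X] → Prop} (h0 : P 0)
    (hadd : ∀ (a : ℝ) (m : ℕ) (q : ℝ[X]), q.degree < m → P q → P (C a * leg m + q)) (q : ℝ[X]) :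
    P q :=
  leg_induction_of_degree_lt (n := q.natDegree + 1) h0 (fun a m r _ => hadd a m r) q
    (degree_le_natDegree.trans_lt (by exact_mod_cast Nat.lt_succ_self _))

lemma energy_leg (m : ℕ) :
    unitIntegral (wt * derivative (leg m) * derivative (leg m)) = m * (m + 1) * legNorm m := by
  have hd : (op (leg m)).degree < (m + 1 : ℕ) :=
    degree_op_lt (by rw [degree_leg]; exact_mod_cast Nat.lt_succ_self _)
  have hc : (op (leg m)).coeff m = -(m * (m + 1)) := by
    have := (leg_monic m).coeff_natDegree
    rw [natDegree_leg] at this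
    rw [coeff_op, this, coeff_eq_zero_of_natDegree_lt (by rw [natDegree_leg]; omega)]
    ring
  have h := unitIntegral_leg_mul (degree_sub_leg_lt hd)
  have h2 : leg m * (op (leg m) - C ((op (leg m)).coeff m) * leg m) =
      leg m * op (leg m) - C ((op (leg m)).coeff m) * (leg m * leg m) := by ring
  rw [h2, map_sub, unitIntegral_C_mul, hc] at h
  rw [energy_eq, legNorm]
  linarith

/-- Spectral gap: the Rayleigh quotient of the Legendre operator on the complement of the
polynomials of degree less than `n`. -/
lemma spectral_gap (n : ℕ) (G : ℝ[X])
    (hG : ∀ q : ℝ[X], q.degree < n → unitIntegral (G * q) = 0) :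
    n * (n + 1) * unitIntegral (G * G) ≤ unitIntegral (wt * derivative G * derivative G) := by
  induction G using leg_induction with
  | h0 => simp
  | hadd a m q hq ih =>
    rcases lt_or_ge m n with hmn | hmn
    · have hd : (C a * leg m + q).degree < n := by
        refine (degree_add_le _ _).trans_lt (max_lt ?_ (hq.trans (by exact_mod_cast hmn)))
        rw [← smul_eq_C_mul]
        refine (degree_smul_le a _).trans_lt ?_
        rw [degree_leg]; exact_mod_cast hmn
      rw [hG _ hd, mul_zero]
      exact energy_self_nonneg _
    · have ih' := ih fun r hr => by
        have h := hG r hr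
        have h2 := unitIntegral_leg_mul (n := m) (hr.trans_le (by exact_mod_cast hmn))
        rw [add_mul, map_add, mul_assoc, unitIntegral_C_mul, h2] at h
        linarith
      have e1 : (C a * leg m + q) * (C a * leg m + q) =
          C (a * a) * (leg m * leg m) + C (2 * a) * (leg m * q) + q * q := by
        simp only [C_mul, C_ofNat]; ring
      have e2 : wt * derivative (C a * leg m + q) * derivative (C a * leg m + q) =
          C (a * a) * (wt * derivative (leg m) * derivative (leg m)) +
            C (2 * a) * (wt * derivative (leg m) * derivative q) +
              wt * derivative q * derivative q := by
        simp only [derivative_add, derivative_C_mul, C_mul, C_ofNat]; ring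
      rw [e1, e2]
      simp only [map_add, unitIntegral_C_mul]
      rw [unitIntegral_leg_mul hq, energy_eq (leg m) q, unitIntegral_leg_mul (degree_op_lt hq),
        energy_leg, ← legNorm]
      have hmn' : (n : ℝ) ≤ m := by exact_mod_cast hmn
      have : (n : ℝ) * (n + 1) ≤ m * (m + 1) := by gcongr
      nlinarith [mul_nonneg (mul_self_nonneg a) (legNorm_pos m).le]

/-- The coefficient of `leg k` in the orthogonal expansion of `g`. -/
def projCoeff (g : ℝ → ℝ) (k : ℕ) : ℝ :=
  (∫ t in (0 : ℝ)..1, g t * (leg k).eval t) / legNorm k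

/-- The `L²(0, 1)`-projection onto the polynomials of degree less than `n`. -/
def proj (n : ℕ) (g : ℝ → ℝ) : ℝ[X] := ∑ k ∈ Finset.range n, C (projCoeff g k) * leg k

lemma degree_proj_lt (n : ℕ) (g : ℝ → ℝ) : (proj n g).degree < n := by
  rw [← mem_degreeLT]
  refine Submodule.sum_mem _ fun k hk => ?_
  rw [← smul_eq_C_mul]
  refine Submodule.smul_mem _ _ (mem_degreeLT.2 ?_)
  rw [degree_leg]
  exact_mod_cast Finset.mem_range.1 hk

lemma unitIntegral_proj_mul_leg {n m : ℕ} (hm : m < n) (g : ℝ → ℝ) :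
    unitIntegral (proj n g * leg m) = ∫ t in (0 : ℝ)..1, g t * (leg m).eval t := by
  rw [proj, Finset.sum_mul, map_sum, Finset.sum_eq_single m]
  · rw [mul_assoc, unitIntegral_C_mul, projCoeff, ← legNorm, div_mul_cancel₀ _ (legNorm_pos m).ne']
  · intro k _ hk
    rw [mul_assoc, unitIntegral_C_mul, unitIntegral_leg_mul_leg hk, mul_zero]
  · intro h
    exact absurd (Finset.mem_range.2 hm) h

lemma integral_sub_proj_mul {n : ℕ} {g : ℝ → ℝ} (hg : Continuous g) (q : ℝ[X])
    (hq : q.degree < n) : ∫ t in (0 : ℝ)..1, (g t - (proj n g).eval t) * q.eval t = 0 := by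
  refine leg_induction_of_degree_lt
    (P := fun q => ∫ t in (0 : ℝ)..1, (g t - (proj n g).eval t) * q.eval t = 0)
    (by simp) (fun a m q hm _ ih => ?_) q hq
  · have h := unitIntegral_proj_mul_leg hm g
    have e : ∀ t, (g t - (proj n g).eval t) * (C a * leg m + q).eval t =
        a * (g t * (leg m).eval t - (proj n g * leg m).eval t) +
          (g t - (proj n g).eval t) * q.eval t := fun t => by
      simp only [eval_add, eval_mul, eval_C]; ring
    simp_rw [e]
    rw [intervalIntegral.integral_add (Continuous.intervalIntegrable (by fun_prop) _ _)
      (Continuous.intervalIntegrable (by fun_prop) _ _), ih, intervalIntegral.integral_const_mul,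
      intervalIntegral.integral_sub (Continuous.intervalIntegrable (by fun_prop) _ _)
      (Continuous.intervalIntegrable (by fun_prop) _ _), ← unitIntegral_apply, h]
    simp

lemma integral_sub_sq_eq {n : ℕ} {g : ℝ → ℝ} (hg : Continuous g) {q : ℝ[X]}
    (hq : q.degree < n) : ∫ t in (0 : ℝ)..1, (g t - q.eval t) ^ 2 =
      (∫ t in (0 : ℝ)..1, (g t - (proj n g).eval t) ^ 2) +
        ∫ t in (0 : ℝ)..1, ((proj n g).eval t - q.eval t) ^ 2 := by
  have hd : (proj n g - q).degree < n :=
    (degree_sub_le _ _).trans_lt (max_lt (degree_proj_lt n g) hq)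
  have e : ∀ t, (g t - q.eval t) ^ 2 = (g t - (proj n g).eval t) ^ 2 +
      2 * ((g t - (proj n g).eval t) * (proj n g - q).eval t) +
        ((proj n g).eval t - q.eval t) ^ 2 := fun t => by
    rw [eval_sub]; ring
  simp_rw [e]
  rw [intervalIntegral.integral_add (Continuous.intervalIntegrable (by fun_prop) _ _)
    (Continuous.intervalIntegrable (by fun_prop) _ _),
    intervalIntegral.integral_add (Continuous.intervalIntegrable (by fun_prop) _ _)
    (Continuous.intervalIntegrable (by fun_prop) _ _), intervalIntegral.integral_const_mul,
    integral_sub_proj_mul hg _ hd, mul_zero, add_zero]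

lemma integral_proj_sq_le (n : ℕ) {g : ℝ → ℝ} (hg : Continuous g) :
    ∫ t in (0 : ℝ)..1, (proj n g).eval t ^ 2 ≤ ∫ t in (0 : ℝ)..1, g t ^ 2 := by
  have h := integral_sub_sq_eq (n := n) hg (q := 0) (by simp)
  simp only [eval_zero, sub_zero] at h
  rw [h]
  exact le_add_of_nonneg_left
    (intervalIntegral.integral_nonneg zero_le_one fun _ _ => sq_nonneg _)

lemma integral_sub_proj_sq_le_sub {n : ℕ} {g : ℝ → ℝ} (hg : Continuous g) {q : ℝ[X]}
    (hq : q.degree < n) : ∫ t in (0 : ℝ)..1, (g t - (proj n g).eval t) ^ 2 ≤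
      ∫ t in (0 : ℝ)..1, (g t - q.eval t) ^ 2 := by
  rw [integral_sub_sq_eq hg hq]
  exact le_add_of_nonneg_right
    (intervalIntegral.integral_nonneg zero_le_one fun _ _ => sq_nonneg _)

lemma integral_sub_proj_sq_le_self (n : ℕ) {g : ℝ → ℝ} (hg : Continuous g) :
    ∫ t in (0 : ℝ)..1, (g t - (proj n g).eval t) ^ 2 ≤ ∫ t in (0 : ℝ)..1, g t ^ 2 := by
  simpa using integral_sub_proj_sq_le_sub (n := n) hg (q := 0) (by simp)

/-- The approximation estimate for polynomials. -/
lemma sq_mul_integral_sub_proj_le_poly (n : ℕ) (G : ℝ[X]) :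
    n ^ 2 * ∫ t in (0 : ℝ)..1, (G.eval t - (proj n fun t => G.eval t).eval t) ^ 2 ≤
      ∫ t in (0 : ℝ)..1, (derivative G).eval t ^ 2 := by
  set P := proj n fun t => G.eval t with hP
  have ho : ∀ q : ℝ[X], q.degree < n → unitIntegral ((G - P) * q) = 0 := fun q hq => by
    simpa [unitIntegral_apply] using integral_sub_proj_mul (n := n) G.continuous q hq
  have h1 := spectral_gap n (G - P) ho
  have hc := energy_eq (G - P) P
  rw [ho _ (degree_op_lt (degree_proj_lt n _)), neg_zero] at hc
  have e : wt * derivative G * derivative G = wt * derivative (G - P) * derivative (G - P) +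
      C 2 * (wt * derivative (G - P) * derivative P) + wt * derivative P * derivative P := by
    simp only [derivative_sub, C_ofNat]; ring
  have h2 : unitIntegral (wt * derivative (G - P) * derivative (G - P)) ≤
      unitIntegral (wt * derivative G * derivative G) := by
    rw [e, map_add, map_add, unitIntegral_C_mul, hc]
    linarith [energy_self_nonneg P]
  have h3 := energy_self_le G
  have h4 := unitIntegral_mul_self_nonneg (G - P)
  have h5 : unitIntegral ((G - P) * (G - P)) = ∫ t in (0 : ℝ)..1, (G.eval t - P.eval t) ^ 2 := by
    simp [unitIntegral_apply, sq]
  have h6 : unitIntegral (derivative G * derivative G) =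
      ∫ t in (0 : ℝ)..1, (derivative G).eval t ^ 2 := by
    simp [unitIntegral_apply, sq]
  rw [← h5, ← h6]
  have : (0 : ℝ) ≤ n := n.cast_nonneg
  nlinarith [mul_nonneg this h4]

lemma exists_antiderivative (r : ℝ[X]) (c : ℝ) :
    ∃ G : ℝ[X], derivative G = r ∧ G.eval 0 = c := by
  induction r using Polynomial.induction_on' generalizing c with
  | add p q hp hq =>
    obtain ⟨P, hP, hP0⟩ := hp c
    obtain ⟨Q, hQ, hQ0⟩ := hq 0
    exact ⟨P + Q, by simp [hP, hQ], by simp [hP0, hQ0]⟩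
  | monomial n a =>
    refine ⟨monomial (n + 1) (a / (n + 1)) + C c, ?_, by simp⟩
    have : (n : ℝ) + 1 ≠ 0 := by positivity
    simp [this]

lemma integral_add_sq_le {f g : ℝ → ℝ} (hf : Continuous f) (hg : Continuous g) :
    ∫ t in (0 : ℝ)..1, (f t + g t) ^ 2 ≤
      2 * (∫ t in (0 : ℝ)..1, f t ^ 2) + 2 * ∫ t in (0 : ℝ)..1, g t ^ 2 := by
  rw [← intervalIntegral.integral_const_mul, ← intervalIntegral.integral_const_mul,
    ← intervalIntegral.integral_add (Continuous.intervalIntegrable (by fun_prop) _ _)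
    (Continuous.intervalIntegrable (by fun_prop) _ _)]
  refine intervalIntegral.integral_mono_on zero_le_one
    (Continuous.intervalIntegrable (by fun_prop) _ _)
    (Continuous.intervalIntegrable (by fun_prop) _ _) fun t _ => ?_
  linarith [add_sq_le (a := f t) (b := g t)]

lemma integral_sq_le_of_abs_le {f : ℝ → ℝ} (hf : Continuous f) {ε : ℝ}
    (h : ∀ t ∈ Set.Icc (0 : ℝ) 1, |f t| ≤ ε) : ∫ t in (0 : ℝ)..1, f t ^ 2 ≤ ε ^ 2 := by
  refine (intervalIntegral.integral_mono_on zero_le_one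
    (Continuous.intervalIntegrable (by fun_prop) _ _)
    (g := fun _ => ε ^ 2) (by simp) fun t ht => ?_).trans (by simp)
  rw [← sq_abs]
  exact pow_le_pow_left₀ (abs_nonneg _) (h t ht) 2

/-- The `L²`-projection converges at rate `1 / n` on functions with continuous derivative. -/
lemma sq_mul_integral_sub_proj_le (n : ℕ) {g g' : ℝ → ℝ} (hg : Continuous g)
    (hg' : Continuous g') (hd : ∀ t ∈ Set.Ioo (0 : ℝ) 1, HasDerivAt g (g' t) t) :
    n ^ 2 * ∫ t in (0 : ℝ)..1, (g t - (proj n g).eval t) ^ 2 ≤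
      4 * ∫ t in (0 : ℝ)..1, g' t ^ 2 := by
  refine le_of_forall_pos_le_add fun δ hδ => ?_
  obtain ⟨ε, hε, hεδ⟩ : ∃ ε > 0, (4 + 2 * (n : ℝ) ^ 2) * ε ^ 2 ≤ δ := by
    have hp : (0 : ℝ) < 4 + 2 * (n : ℝ) ^ 2 := by positivity
    refine ⟨√(δ / (4 + 2 * (n : ℝ) ^ 2)), by positivity, ?_⟩
    rw [Real.sq_sqrt (by positivity), mul_div_cancel₀ _ hp.ne']
  obtain ⟨r, hr⟩ := exists_polynomial_near_of_continuousOn 0 1 g' hg'.continuousOn ε hε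
  obtain ⟨G, hG, hG0⟩ := exists_antiderivative r (g 0)
  have hGg : ∀ t ∈ Set.Icc (0 : ℝ) 1, |g t - G.eval t| ≤ ε := by
    intro t ht
    have hF : ∫ s in (0 : ℝ)..t, (g' s - r.eval s) = g t - G.eval t := by
      rw [intervalIntegral.integral_eq_sub_of_hasDerivAt_of_le (f := fun s => g s - G.eval s) ht.1
        (by fun_prop)
        (fun s hs => (hd s ⟨hs.1, hs.2.trans_le ht.2⟩).sub (hG ▸ G.hasDerivAt s))
        (Continuous.intervalIntegrable (by fun_prop) _ _)]
      simp [hG0]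
    rw [← hF]
    refine (intervalIntegral.norm_integral_le_of_norm_le_const (C := ε) (a := 0) (b := t)
      (f := fun s => g' s - r.eval s) fun s hs => ?_).trans ?_
    · rw [Set.uIoc_of_le ht.1] at hs
      rw [Real.norm_eq_abs, abs_sub_comm]
      exact (hr s ⟨hs.1.le, hs.2.trans ht.2⟩).le
    · rw [sub_zero, abs_of_nonneg ht.1]
      nlinarith [ht.2]
  have h1 := sq_mul_integral_sub_proj_le_poly n G
  rw [hG] at h1
  set P := proj n fun t => G.eval t
  have h2 := integral_sub_proj_sq_le_sub hg (degree_proj_lt n fun t => G.eval t)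
  have h3 := integral_add_sq_le (f := fun t => G.eval t - P.eval t) (g := fun t => g t - G.eval t)
    (by fun_prop) (by fun_prop)
  have h4 := integral_sq_le_of_abs_le (by fun_prop) hGg
  have h5 := integral_add_sq_le (f := g') (g := fun t => r.eval t - g' t)
    (by fun_prop) (by fun_prop)
  have h6 := integral_sq_le_of_abs_le (f := fun t => r.eval t - g' t) (by fun_prop)
    fun t ht => (hr t ht).le
  have e3 : ∀ t, G.eval t - P.eval t + (g t - G.eval t) = g t - P.eval t := fun t => by ring
  have e5 : ∀ t, g' t + (r.eval t - g' t) = r.eval t := fun t => by ring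
  simp only [e3] at h3
  simp only [e5] at h5
  have hn : (0 : ℝ) ≤ (n : ℝ) ^ 2 := by positivity
  have := mul_le_mul_of_nonneg_left (h2.trans h3) hn
  have := mul_le_mul_of_nonneg_left h4 hn
  linarith

/-- The antiderivative of `leg k` vanishing at `0`. -/
def ileg (k : ℕ) : ℝ[X] := (exists_antiderivative (leg k) 0).choose

lemma derivative_ileg (k : ℕ) : derivative (ileg k) = leg k :=
  (exists_antiderivative (leg k) 0).choose_spec.1

lemma ileg_eval_zero (k : ℕ) : (ileg k).eval 0 = 0 :=
  (exists_antiderivative (leg k) 0).choose_spec.2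

lemma ileg_eval_one {k : ℕ} (hk : k ≠ 0) : (ileg k).eval 1 = 0 := by
  have h := unitIntegral_derivative (ileg k)
  have h1 := unitIntegral_leg_mul (n := k) (q := 1)
    (degree_one_le.trans_lt (by exact_mod_cast Nat.pos_of_ne_zero hk))
  rw [mul_one] at h1
  rw [derivative_ileg, h1, ileg_eval_zero] at h
  linarith

lemma natDegree_ileg_le (k : ℕ) : (ileg k).natDegree ≤ k + 1 := by
  rw [natDegree_le_iff_coeff_eq_zero]
  intro m hm
  obtain ⟨m, rfl⟩ : ∃ j, m = j + 1 := ⟨m - 1, by omega⟩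
  have h := coeff_derivative (ileg k) m
  rw [derivative_ileg, coeff_eq_zero_of_natDegree_lt (by rw [natDegree_leg]; omega)] at h
  have : (m : ℝ) + 1 ≠ 0 := by positivity
  exact (mul_eq_zero.1 h.symm).resolve_right this

/-- The coefficient of `ileg k` in the bubble approximation of `f`. -/
def bubCoeff (f : ℝ → ℝ) (k : ℕ) : ℝ :=
  -(∫ t in (0 : ℝ)..1, f t * (derivative (leg k)).eval t) / legNorm k

/-- The bubble approximation of degree at most `n`, whose derivative is the `L²`-projection of
the derivative. -/
def bub (n : ℕ) (f : ℝ → ℝ) : ℝ[X] := ∑ k ∈ Finset.range n, C (bubCoeff f k) * ileg k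

lemma bubCoeff_mul_ileg_eval_one (f : ℝ → ℝ) (k : ℕ) : bubCoeff f k * (ileg k).eval 1 = 0 := by
  rcases eq_or_ne k 0 with rfl | hk
  · simp [bubCoeff, leg_zero]
  · rw [ileg_eval_one hk, mul_zero]

lemma bub_eval_zero (n : ℕ) (f : ℝ → ℝ) : (bub n f).eval 0 = 0 := by
  simp [bub, eval_finsetSum, ileg_eval_zero]

lemma bub_eval_one (n : ℕ) (f : ℝ → ℝ) : (bub n f).eval 1 = 0 := by
  simp [bub, eval_finsetSum, bubCoeff_mul_ileg_eval_one]

lemma derivative_bub (n : ℕ) {f f' : ℝ → ℝ} (hf : Continuous f) (hf' : Continuous f')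
    (hd : ∀ t ∈ Set.Ioo (0 : ℝ) 1, HasDerivAt f (f' t) t) (h0 : f 0 = 0) (h1 : f 1 = 0) :
    derivative (bub n f) = proj n f' := by
  rw [bub, proj, derivative_sum]
  refine Finset.sum_congr rfl fun k _ => ?_
  rw [derivative_C_mul, derivative_ileg, bubCoeff, projCoeff]
  congr 3
  have h := intervalIntegral.integral_mul_deriv_eq_deriv_mul_of_hasDerivAt (a := 0) (b := 1)
    (u := f) (u' := f') (v := fun t => (leg k).eval t)
    (v' := fun t => (derivative (leg k)).eval t) hf.continuousOn (leg k).continuousOn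
    (by simpa using hd) (fun t _ => (leg k).hasDerivAt t)
    (hf'.intervalIntegrable _ _) (Continuous.intervalIntegrable (by fun_prop) _ _)
  rw [h, h0, h1]
  ring

/-- The bubble approximation converges at rate `1 / n`, by duality. -/
lemma sq_mul_integral_sub_bub_le {n : ℕ} (hn : 1 ≤ n) {f f' : ℝ → ℝ} (hf : Continuous f)
    (hf' : Continuous f') (hd : ∀ t ∈ Set.Ioo (0 : ℝ) 1, HasDerivAt f (f' t) t)
    (h0 : f 0 = 0) (h1 : f 1 = 0) :
    n ^ 2 * ∫ t in (0 : ℝ)..1, (f t - (bub n f).eval t) ^ 2 ≤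
      4 * ∫ t in (0 : ℝ)..1, f' t ^ 2 := by
  set e : ℝ → ℝ := fun t => f t - (bub n f).eval t with he
  set e' : ℝ → ℝ := fun t => f' t - (proj n f').eval t with he'
  have hec : Continuous e := by fun_prop
  have hec' : Continuous e' := by fun_prop
  have hed : ∀ t ∈ Set.Ioo (0 : ℝ) 1, HasDerivAt e (e' t) t := fun t ht =>
    (hd t ht).sub (derivative_bub n hf hf' hd h0 h1 ▸ (bub n f).hasDerivAt t)
  set ψ : ℝ → ℝ := fun x => ∫ t in (0 : ℝ)..x, e t with hψ
  have hψd : ∀ t, HasDerivAt ψ (e t) t := fun t => hec.integral_hasStrictDerivAt 0 t |>.hasDerivAt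
  have hψc : Continuous ψ := continuous_iff_continuousAt.2 fun t => (hψd t).continuousAt
  have hibp := intervalIntegral.integral_mul_deriv_eq_deriv_mul_of_hasDerivAt (a := 0) (b := 1)
    (u := e) (u' := e') (v := ψ) (v' := e) hec.continuousOn hψc.continuousOn
    (by simpa using hed) (fun t _ => hψd t)
    (hec'.intervalIntegrable _ _) (hec.intervalIntegrable _ _)
  have he0 : e 0 = 0 := by simp [he, h0, bub_eval_zero]
  have he1 : e 1 = 0 := by simp [he, h1, bub_eval_one]
  rw [he0, he1, zero_mul, zero_mul, sub_zero, zero_sub] at hibp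
  have horth := integral_sub_proj_mul hf' (proj n ψ) (degree_proj_lt n ψ)
  have hest := sq_mul_integral_sub_proj_le n hψc hec fun t _ => hψd t
  have hle := integral_sub_proj_sq_le_self n hf'
  have hn' : (0 : ℝ) < (n : ℝ) ^ 2 := by positivity
  set φ : ℝ → ℝ := fun t => ψ t - (proj n ψ).eval t with hφ
  have hφc : Continuous φ := by fun_prop
  have hint : ∀ {h : ℝ → ℝ}, Continuous h → IntervalIntegrable h volume 0 1 :=
    fun h => h.intervalIntegrable _ _
  have hsplit : ∫ t in (0 : ℝ)..1, e' t * ψ t = ∫ t in (0 : ℝ)..1, e' t * φ t := by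
    have : ∀ t, e' t * ψ t = e' t * φ t + e' t * (proj n ψ).eval t := fun t => by
      simp only [hφ]; ring
    simp_rw [this]
    rw [intervalIntegral.integral_add (hint (by fun_prop)) (hint (by fun_prop)), horth, add_zero]
  have hyoung : 8 * (n ^ 2 * -∫ t in (0 : ℝ)..1, e' t * φ t) ≤
      16 * (∫ t in (0 : ℝ)..1, e' t ^ 2) + n ^ 2 * (n ^ 2 * ∫ t in (0 : ℝ)..1, φ t ^ 2) := by
    rw [← intervalIntegral.integral_neg]
    simp only [← intervalIntegral.integral_const_mul]
    rw [← intervalIntegral.integral_add (hint (by fun_prop)) (hint (by fun_prop))]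
    refine intervalIntegral.integral_mono_on zero_le_one (hint (by fun_prop))
      (hint (by fun_prop)) fun t _ => ?_
    nlinarith [sq_nonneg (4 * e' t + n ^ 2 * φ t)]
  have hsq : ∫ t in (0 : ℝ)..1, e t * e t = ∫ t in (0 : ℝ)..1, e t ^ 2 := by simp only [sq]
  rw [← hsplit, ← hibp, hsq] at hyoung
  have := mul_le_mul_of_nonneg_left hest hn'.le
  linarith

lemma projCoeff_sub {g h : ℝ → ℝ} (hg : Continuous g) (hh : Continuous h) (k : ℕ) :
    projCoeff (fun t => g t - h t) k = projCoeff g k - projCoeff h k := by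
  simp only [projCoeff, sub_mul]
  rw [intervalIntegral.integral_sub (Continuous.intervalIntegrable (by fun_prop) _ _)
    (Continuous.intervalIntegrable (by fun_prop) _ _), sub_div]

lemma proj_sub (n : ℕ) {g h : ℝ → ℝ} (hg : Continuous g) (hh : Continuous h) :
    proj n (fun t => g t - h t) = proj n g - proj n h := by
  simp only [proj, projCoeff_sub hg hh, C_sub, sub_mul, Finset.sum_sub_distrib]

lemma projCoeff_sum_mul {ι : Type*} (s : Finset ι) (a : ι → ℝ) {g : ι → ℝ → ℝ}
    (hg : ∀ j ∈ s, Continuous (g j)) (k : ℕ) :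
    projCoeff (fun t => ∑ j ∈ s, g j t * a j) k = ∑ j ∈ s, projCoeff (g j) k * a j := by
  simp only [projCoeff, Finset.sum_mul]
  rw [intervalIntegral.integral_finsetSum fun j hj =>
    Continuous.intervalIntegrable (by have := hg j hj; fun_prop) _ _, Finset.sum_div]
  refine Finset.sum_congr rfl fun j _ => ?_
  rw [div_mul_eq_mul_div, ← intervalIntegral.integral_mul_const]
  congr 2 with t
  ring

lemma continuous_projCoeff {X : Type*} [TopologicalSpace X] [FirstCountableTopology X]
    {v : X → ℝ → ℝ} (hv : Continuous v.uncurry) (k : ℕ) :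
    Continuous fun x => projCoeff (v x) k := by
  refine Continuous.div_const
    (intervalIntegral.continuous_parametric_intervalIntegral_of_continuous' ?_ _ _) _
  exact hv.mul ((leg k).continuous.comp continuous_snd)

lemma continuous_bubCoeff {X : Type*} [TopologicalSpace X] [FirstCountableTopology X]
    {v : X → ℝ → ℝ} (hv : Continuous v.uncurry) (k : ℕ) :
    Continuous fun x => bubCoeff (v x) k := by
  refine (Continuous.neg
    (intervalIntegral.continuous_parametric_intervalIntegral_of_continuous' ?_ _ _)).div_const _
  exact hv.mul ((derivative (leg k)).continuous.comp continuous_snd)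

lemma continuous_proj {X : Type*} [TopologicalSpace X] [FirstCountableTopology X]
    {v : X → ℝ → ℝ} (hv : Continuous v.uncurry) (n : ℕ) :
    Continuous fun z : X × ℝ => (proj n (v z.1)).eval z.2 := by
  simp only [proj, eval_finsetSum, eval_mul, eval_C]
  exact continuous_finsetSum _ fun k _ => ((continuous_projCoeff hv k).comp continuous_fst).mul
    ((leg k).continuous.comp continuous_snd)

lemma continuous_bub {X : Type*} [TopologicalSpace X] [FirstCountableTopology X]
    {v : X → ℝ → ℝ} (hv : Continuous v.uncurry) (n : ℕ) :
    Continuous fun z : X × ℝ => (bub n (v z.1)).eval z.2 := by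
  simp only [bub, eval_finsetSum, eval_mul, eval_C]
  exact continuous_finsetSum _ fun k _ => ((continuous_bubCoeff hv k).comp continuous_fst).mul
    ((ileg k).continuous.comp continuous_snd)

end UnitLegendre

lemma IsPoly2.add {p₁ p₂ : ℕ} {f g : ℝ × ℝ → ℂ} (hf : IsPoly2 p₁ p₂ f) (hg : IsPoly2 p₁ p₂ g) :
    IsPoly2 p₁ p₂ fun x => f x + g x := by
  obtain ⟨c, hc⟩ := hf
  obtain ⟨d, hd⟩ := hg
  refine ⟨fun i j => c i j + d i j, fun x => ?_⟩
  simp only [hc, hd, add_mul, Finset.sum_add_distrib]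

lemma IsPoly2.const_mul {p₁ p₂ : ℕ} {f : ℝ × ℝ → ℂ} (hf : IsPoly2 p₁ p₂ f) (a : ℂ) :
    IsPoly2 p₁ p₂ fun x => a * f x := by
  obtain ⟨c, hc⟩ := hf
  refine ⟨fun i j => a * c i j, fun x => ?_⟩
  simp only [hc, Finset.mul_sum, mul_assoc]

lemma IsPoly2.sum {ι : Type*} {p₁ p₂ : ℕ} {f : ι → ℝ × ℝ → ℂ} (s : Finset ι)
    (hf : ∀ i ∈ s, IsPoly2 p₁ p₂ (f i)) : IsPoly2 p₁ p₂ fun x => ∑ i ∈ s, f i x := by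
  classical
  induction s using Finset.induction_on with
  | empty => exact ⟨0, by simp⟩
  | insert i s hi ih =>
    simp only [Finset.sum_insert hi]
    exact (hf i (Finset.mem_insert_self i s)).add
      (ih fun j hj => hf j (Finset.mem_insert_of_mem hj))

lemma IsPoly2.comp_swap {p₁ p₂ : ℕ} {f : ℝ × ℝ → ℂ} (hf : IsPoly2 p₁ p₂ f) :
    IsPoly2 p₂ p₁ fun x => f x.swap := by
  obtain ⟨c, hc⟩ := hf
  refine ⟨fun j i => c i j, fun x => ?_⟩
  beta_reduce
  rw [hc, Finset.sum_comm]
  refine Finset.sum_congr rfl fun i _ => Finset.sum_congr rfl fun j _ => ?_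
  simp only [Prod.fst_swap, Prod.snd_swap]
  ring

lemma isPoly2_eval_mul_eval {p₁ p₂ : ℕ} {P R : Polynomial ℝ} (hP : P.natDegree ≤ p₁)
    (hR : R.natDegree ≤ p₂) : IsPoly2 p₁ p₂ fun x => ((P.eval x.1 * R.eval x.2 : ℝ) : ℂ) := by
  refine ⟨fun i j => P.coeff i * R.coeff j, fun x => ?_⟩
  beta_reduce
  rw [Polynomial.eval_eq_sum_range' (Nat.lt_succ_of_le hP),
    Polynomial.eval_eq_sum_range' (Nat.lt_succ_of_le hR), Finset.sum_range, Finset.sum_range,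
    Finset.sum_mul_sum]
  push_cast
  refine Finset.sum_congr rfl fun i _ => Finset.sum_congr rfl fun j _ => ?_
  ring

lemma IsPoly2.continuous {p₁ p₂ : ℕ} {f : ℝ × ℝ → ℂ} (hf : IsPoly2 p₁ p₂ f) : Continuous f := by
  obtain ⟨c, hc⟩ := hf
  rw [funext hc]
  fun_prop

section Square

open UnitLegendre Polynomial

lemma integral_sq_swap {F : ℝ → ℝ → ℝ} (hF : Continuous F.uncurry) :
    ∫ x in (0 : ℝ)..1, ∫ y in (0 : ℝ)..1, F x y ^ 2 =
      ∫ y in (0 : ℝ)..1, ∫ x in (0 : ℝ)..1, F x y ^ 2 :=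
  intervalIntegral_intervalIntegral_swap <|
    ((hF.pow 2).continuousOn.integrableOn_compact (isCompact_uIcc.prod isCompact_uIcc)).mono_set
      (Set.prod_mono Set.uIoc_subset_uIcc Set.uIoc_subset_uIcc)

lemma intervalIntegrable_integral_sq {F : ℝ → ℝ → ℝ} (hF : Continuous F.uncurry) :
    IntervalIntegrable (fun x => ∫ y in (0 : ℝ)..1, F x y ^ 2) volume 0 1 := by
  have h : Continuous (fun x y => F x y ^ 2 : ℝ → ℝ → ℝ).uncurry := hF.pow 2
  exact (intervalIntegral.continuous_parametric_intervalIntegral_of_continuous'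
    h _ _).intervalIntegrable _ _

/-- The mixed bubble / projection approximation of a real function on the unit square. -/
lemma exists_real_approx {p : ℕ} (hp : 1 ≤ p) {v vx vy : ℝ → ℝ → ℝ}
    (hv : Continuous v.uncurry) (hvx : Continuous vx.uncurry) (hvy : Continuous vy.uncurry)
    (hdx : ∀ x ∈ Set.Ioo (0 : ℝ) 1, ∀ y ∈ Set.Ioo (0 : ℝ) 1,
      HasDerivAt (fun s => v s y) (vx x y) x)
    (hdy : ∀ x ∈ Set.Ioo (0 : ℝ) 1, ∀ y ∈ Set.Ioo (0 : ℝ) 1, HasDerivAt (v x) (vy x y) y)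
    (h0 : ∀ y ∈ Set.Icc (0 : ℝ) 1, v 0 y = 0) (h1 : ∀ y ∈ Set.Icc (0 : ℝ) 1, v 1 y = 0) :
    ∃ q : ℝ × ℝ → ℝ, IsPoly2 p (p - 1) (fun x => (q x : ℂ)) ∧
      (∀ y, q (0, y) = 0 ∧ q (1, y) = 0) ∧
      p ^ 2 * ∫ x in (0 : ℝ)..1, ∫ y in (0 : ℝ)..1, (v x y - q (x, y)) ^ 2 ≤
        8 * ((∫ x in (0 : ℝ)..1, ∫ y in (0 : ℝ)..1, vx x y ^ 2) +
          ∫ x in (0 : ℝ)..1, ∫ y in (0 : ℝ)..1, vy x y ^ 2) := by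
  have hvs : Continuous (fun y x => v x y : ℝ → ℝ → ℝ).uncurry := hv.comp continuous_swap
  have hvxs : Continuous (fun y x => vx x y : ℝ → ℝ → ℝ).uncurry := hvx.comp continuous_swap
  have hvr : ∀ x, Continuous (v x) := fun x => hv.comp (Continuous.prodMk_right x)
  have hvc : ∀ y, Continuous fun s => v s y := fun y => hv.comp (Continuous.prodMk_left y)
  set A : ℝ → ℝ → ℝ := fun x y => (bub p fun s => v s y).eval x with hAdef
  have hAs : Continuous (fun y x => A x y : ℝ → ℝ → ℝ).uncurry := continuous_bub hvs p
  have hA : Continuous A.uncurry := hAs.comp continuous_swap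
  have hAr : ∀ x, Continuous (A x) := fun x => hA.comp (Continuous.prodMk_right x)
  set Q : ℝ → ℝ → ℝ := fun x y => (proj p (A x)).eval y with hQdef
  have hQ : Continuous Q.uncurry := continuous_proj hA p
  set E : ℝ → ℝ → ℝ := fun x y => v x y - A x y with hEdef
  have hE : Continuous E.uncurry := hv.sub hA
  have hEr : ∀ x, Continuous (E x) := fun x => hE.comp (Continuous.prodMk_right x)
  refine ⟨fun z => Q z.1 z.2, ?_, fun y => ?_, ?_⟩
  · have hexp : ∀ z : ℝ × ℝ, ((Q z.1 z.2 : ℝ) : ℂ) = ∑ k ∈ Finset.range p, ∑ j ∈ Finset.range p,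
        ((projCoeff (fun t => bubCoeff (fun s => v s t) j) k : ℝ) : ℂ) *
          (((ileg j).eval z.1 * (leg k).eval z.2 : ℝ) : ℂ) := by
      intro z
      have hAz : A z.1 = fun t => ∑ j ∈ Finset.range p,
          bubCoeff (fun s => v s t) j * (ileg j).eval z.1 := by
        ext t
        simp only [hAdef, bub, eval_finsetSum, eval_mul, eval_C]
      have hQz : Q z.1 z.2 = ∑ k ∈ Finset.range p, ∑ j ∈ Finset.range p,
          projCoeff (fun t => bubCoeff (fun s => v s t) j) k *
            ((ileg j).eval z.1 * (leg k).eval z.2) := by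
        simp only [hQdef, proj, eval_finsetSum, eval_mul, eval_C, hAz]
        refine Finset.sum_congr rfl fun k _ => ?_
        rw [projCoeff_sum_mul _ _ fun j _ => continuous_bubCoeff hvs j, Finset.sum_mul]
        simp only [mul_assoc]
      rw [hQz]
      push_cast
      rfl
    simp only [hexp]
    refine IsPoly2.sum _ fun k hk => IsPoly2.sum _ fun j hj => IsPoly2.const_mul ?_ _
    rw [Finset.mem_range] at hk hj
    exact isPoly2_eval_mul_eval ((natDegree_ileg_le j).trans hj) (by rw [natDegree_leg]; omega)
  · constructor <;> simp [hQdef, hAdef, bub_eval_zero, bub_eval_one, proj, projCoeff]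
  · have hp2 : (0 : ℝ) ≤ (p : ℝ) ^ 2 := by positivity
    have hEx : p ^ 2 * ∫ x in (0 : ℝ)..1, ∫ y in (0 : ℝ)..1, E x y ^ 2 ≤
        4 * ∫ x in (0 : ℝ)..1, ∫ y in (0 : ℝ)..1, vx x y ^ 2 := by
      rw [integral_sq_swap hE,
        integral_sq_swap hvx,
        ← intervalIntegral.integral_const_mul, ← intervalIntegral.integral_const_mul]
      refine intervalIntegral.integral_mono_on_of_le_Ioo zero_le_one
        ((intervalIntegrable_integral_sq (F := fun y x => E x y)
          (hE.comp continuous_swap)).const_mul _)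
        ((intervalIntegrable_integral_sq hvxs).const_mul _) fun y hy => ?_
      have hyc := Set.Ioo_subset_Icc_self hy
      exact sq_mul_integral_sub_bub_le hp (hvc y) (hvx.comp (Continuous.prodMk_left y))
        (fun x hx => hdx x hx y hy) (h0 y hyc) (h1 y hyc)
    have hslice : ∀ x ∈ Set.Ioo (0 : ℝ) 1, p ^ 2 * ∫ y in (0 : ℝ)..1, (v x y - Q x y) ^ 2 ≤
        8 * (∫ y in (0 : ℝ)..1, vy x y ^ 2) + 2 * (p ^ 2 * ∫ y in (0 : ℝ)..1, E x y ^ 2) := by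
      intro x hx
      have hs := integral_add_sq_le (f := fun t => v x t - (proj p (v x)).eval t)
        (g := fun t => (proj p (E x)).eval t) ((hvr x).sub (Polynomial.continuous _))
        (Polynomial.continuous _)
      have e : ∀ t, v x t - (proj p (v x)).eval t + (proj p (E x)).eval t = v x t - Q x t := by
        intro t
        rw [hEdef, proj_sub p (hvr x) (hAr x), eval_sub]
        ring
      simp only [e] at hs
      have ha := sq_mul_integral_sub_proj_le p (hvr x) (hvy.comp (Continuous.prodMk_right x))
        fun y hy => hdy x hx y hy
      have hb := mul_le_mul_of_nonneg_left (integral_proj_sq_le p (hEr x)) hp2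
      have hc := mul_le_mul_of_nonneg_left hs hp2
      simp only [Function.comp_def, Function.uncurry_apply_pair] at ha
      linarith
    have hD : Continuous (fun x y => v x y - Q x y : ℝ → ℝ → ℝ).uncurry := hv.sub hQ
    have hI := intervalIntegral.integral_mono_on_of_le_Ioo zero_le_one
      ((intervalIntegrable_integral_sq hD).const_mul _)
      (((intervalIntegrable_integral_sq hvy).const_mul _).add
        (((intervalIntegrable_integral_sq hE).const_mul _).const_mul _)) hslice
    rw [intervalIntegral.integral_add ((intervalIntegrable_integral_sq hvy).const_mul _)
        (((intervalIntegrable_integral_sq hE).const_mul _).const_mul _)] at hI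
    simp only [intervalIntegral.integral_const_mul] at hI
    linarith


lemma closure_Ksq : closure Ksq = Set.Icc (0 : ℝ) 1 ×ˢ Set.Icc (0 : ℝ) 1 := by
  rw [Ksq, closure_prod_eq, closure_Ioo zero_ne_one]

lemma measurableSet_Ksq : MeasurableSet Ksq := measurableSet_Ioo.prod measurableSet_Ioo

lemma integrableOn_Ksq {E : Type*} [NormedAddCommGroup E] {f : ℝ × ℝ → E}
    (hf : ContinuousOn f (closure Ksq)) : IntegrableOn f Ksq := by
  refine (hf.integrableOn_compact ?_).mono_set subset_closure
  rw [closure_Ksq]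
  exact isCompact_Icc.prod isCompact_Icc

lemma setIntegral_Ksq {F : ℝ × ℝ → ℝ} (hF : Continuous F) :
    ∫ z in Ksq, F z = ∫ x in (0 : ℝ)..1, ∫ y in (0 : ℝ)..1, F (x, y) := by
  simp only [intervalIntegral.integral_of_le zero_le_one, integral_Ioc_eq_integral_Ioo]
  exact setIntegral_prod F (integrableOn_Ksq hF.continuousOn)

/-- The nearest-point map onto the closed unit square. -/
def clampSq (z : ℝ × ℝ) : ℝ × ℝ :=
  (Set.projIcc (0 : ℝ) 1 zero_le_one z.1, Set.projIcc (0 : ℝ) 1 zero_le_one z.2)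

lemma continuous_clampSq : Continuous clampSq := by
  unfold clampSq
  fun_prop

lemma clampSq_mem (z : ℝ × ℝ) : clampSq z ∈ closure Ksq := by
  rw [closure_Ksq]
  exact ⟨Subtype.coe_prop _, Subtype.coe_prop _⟩

lemma clampSq_of_mem {z : ℝ × ℝ} (hz : z ∈ closure Ksq) : clampSq z = z := by
  rw [closure_Ksq] at hz
  simp [clampSq, Set.projIcc_of_mem _ hz.1, Set.projIcc_of_mem _ hz.2]

/-- Approximation of one real component of a continuously differentiable field that vanishes on
the two vertical sides. -/
lemma exists_component_approx {E : Type*} [NormedAddCommGroup E] [NormedSpace ℝ E] {p : ℕ}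
    (hp : 1 ≤ p) {u : ℝ × ℝ → E} {U : Set (ℝ × ℝ)} (hU : IsOpen U) (hKU : closure Ksq ⊆ U)
    (hu : ContDiffOn ℝ 1 u U) (L : E →L[ℝ] ℝ) (hL : ‖L‖ ≤ 1)
    (h0 : ∀ t ∈ Set.Icc (0 : ℝ) 1, L (u (0, t)) = 0 ∧ L (u (1, t)) = 0) :
    ∃ q : ℝ × ℝ → ℝ, IsPoly2 p (p - 1) (fun z => (q z : ℂ)) ∧
      (∀ t, q (0, t) = 0 ∧ q (1, t) = 0) ∧
      p ^ 2 * ∫ z in Ksq, (L (u z) - q z) ^ 2 ≤ 16 * ∫ z in Ksq, ‖fderiv ℝ u z‖ ^ 2 := by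
  have huc : ContinuousOn u (closure Ksq) := hu.continuousOn.mono hKU
  have hfc : ContinuousOn (fderiv ℝ u) (closure Ksq) :=
    (hu.continuousOn_fderiv_of_isOpen hU le_rfl).mono hKU
  have hd : ∀ z ∈ Ksq, HasFDerivAt (fun z => L (u z)) (L.comp (fderiv ℝ u z)) z := fun z hz =>
    L.hasFDerivAt.comp z ((hu.differentiableOn one_ne_zero).differentiableAt
      (hU.mem_nhds (hKU (subset_closure hz)))).hasFDerivAt
  have hv : Continuous fun z => L (u (clampSq z)) :=
    L.continuous.comp (huc.comp_continuous continuous_clampSq clampSq_mem)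
  have hdv : ∀ e, Continuous fun z => L (fderiv ℝ u (clampSq z) e) := fun e =>
    L.continuous.comp ((hfc.comp_continuous continuous_clampSq clampSq_mem).clm_apply
      continuous_const)
  have hcl : ∀ x ∈ Set.Ioo (0 : ℝ) 1, ∀ y ∈ Set.Ioo (0 : ℝ) 1, clampSq (x, y) = (x, y) :=
    fun x hx y hy => clampSq_of_mem (subset_closure ⟨hx, hy⟩)
  have hclI : ∀ x ∈ Set.Icc (0 : ℝ) 1, ∀ y ∈ Set.Icc (0 : ℝ) 1, clampSq (x, y) = (x, y) :=
    fun x hx y hy => clampSq_of_mem (by rw [closure_Ksq]; exact ⟨hx, hy⟩)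
  obtain ⟨q, hq, hq0, hqe⟩ := exists_real_approx hp (v := fun x y => L (u (clampSq (x, y))))
    (vx := fun x y => L (fderiv ℝ u (clampSq (x, y)) (1, 0)))
    (vy := fun x y => L (fderiv ℝ u (clampSq (x, y)) (0, 1))) hv (hdv _) (hdv _)
    (fun x hx y hy => by
      have h := (hd (x, y) ⟨hx, hy⟩).comp_hasDerivAt x
        ((hasDerivAt_id x).prodMk (hasDerivAt_const x y))
      rw [hcl x hx y hy]
      refine h.congr_of_eventuallyEq ?_
      filter_upwards [isOpen_Ioo.mem_nhds hx] with s hs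
      simp [hcl s hs y hy])
    (fun x hx y hy => by
      have h := (hd (x, y) ⟨hx, hy⟩).comp_hasDerivAt y
        ((hasDerivAt_const y x).prodMk (hasDerivAt_id y))
      rw [hcl x hx y hy]
      refine h.congr_of_eventuallyEq ?_
      filter_upwards [isOpen_Ioo.mem_nhds hy] with s hs
      simp [hcl x hx s hs])
    (fun y hy => by rw [hclI 0 (by simp) y hy]; exact (h0 y hy).1)
    (fun y hy => by rw [hclI 1 (by simp) y hy]; exact (h0 y hy).2)
  have hqc : Continuous q := by
    simpa [Function.comp_def] using Complex.continuous_re.comp hq.continuous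
  have hle : ∀ e : ℝ × ℝ, ‖e‖ ≤ 1 → ∫ z in Ksq, L (fderiv ℝ u (clampSq z) e) ^ 2 ≤
      ∫ z in Ksq, ‖fderiv ℝ u z‖ ^ 2 := fun e he => by
    refine setIntegral_mono_on (integrableOn_Ksq ((hdv e).pow 2).continuousOn)
      (integrableOn_Ksq (hfc.norm.pow 2)) measurableSet_Ksq fun z hz => ?_
    rw [clampSq_of_mem (subset_closure hz), ← sq_abs, ← Real.norm_eq_abs]
    refine pow_le_pow_left₀ (norm_nonneg _) ?_ 2
    exact (L.le_of_opNorm_le_of_le hL ((fderiv ℝ u z).le_opNorm_of_le he)).trans (by simp)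
  refine ⟨q, hq, hq0, ?_⟩
  have e1 : ∫ z in Ksq, (L (u z) - q z) ^ 2 = ∫ z in Ksq, (L (u (clampSq z)) - q z) ^ 2 :=
    setIntegral_congr_fun measurableSet_Ksq fun z hz => by
      simp only [clampSq_of_mem (subset_closure hz)]
  have hc : Continuous fun z => (L (u (clampSq z)) - q z) ^ 2 := (hv.sub hqc).pow 2
  have hdc : ∀ e, Continuous fun z => L (fderiv ℝ u (clampSq z) e) ^ 2 := fun e => (hdv e).pow 2
  rw [e1, setIntegral_Ksq hc]
  have hx := hle (1, 0) (by simp)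
  have hy := hle (0, 1) (by simp)
  rw [setIntegral_Ksq (hdc _)] at hx hy
  linarith

end Square

lemma norm_fderiv_comp_swap_le {E : Type*} [NormedAddCommGroup E] [NormedSpace ℝ E]
    {u : ℝ × ℝ → E} {z : ℝ × ℝ} (hu : DifferentiableAt ℝ u z.swap) :
    ‖fderiv ℝ (fun z => u z.swap) z‖ ≤ ‖fderiv ℝ u z.swap‖ := by
  have h : HasFDerivAt (fun z => u z.swap)
      ((fderiv ℝ u z.swap).comp
        (ContinuousLinearEquiv.prodComm ℝ ℝ ℝ : ℝ × ℝ →L[ℝ] ℝ × ℝ)) z :=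
    HasFDerivAt.comp (f := Prod.swap) z hu.hasFDerivAt
      (ContinuousLinearEquiv.prodComm ℝ ℝ ℝ).hasFDerivAt
  rw [h.fderiv]
  refine ContinuousLinearMap.opNorm_le_bound _ (norm_nonneg _) fun x => ?_
  refine ((fderiv ℝ u z.swap).le_opNorm _).trans_eq ?_
  simp [Prod.norm_def, max_comm]

lemma setIntegral_Ksq_swap (f : ℝ × ℝ → ℝ) : ∫ z in Ksq, f z.swap = ∫ z in Ksq, f z :=
  setIntegral_prod_swap _ _ f

lemma integral_fderiv_comp_swap_le {E : Type*} [NormedAddCommGroup E] [NormedSpace ℝ E]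
    {u : ℝ × ℝ → E} {U : Set (ℝ × ℝ)} (hU : IsOpen U) (hKU : closure Ksq ⊆ U)
    (hu : ContDiffOn ℝ 1 u U) :
    ∫ z in Ksq, ‖fderiv ℝ (fun z => u z.swap) z‖ ^ 2 ≤ ∫ z in Ksq, ‖fderiv ℝ u z‖ ^ 2 := by
  rw [← setIntegral_Ksq_swap fun z => ‖fderiv ℝ u z‖ ^ 2]
  have hfc : ContinuousOn (fderiv ℝ u) (closure Ksq) :=
    (hu.continuousOn_fderiv_of_isOpen hU le_rfl).mono hKU
  have hmaps : Set.MapsTo Prod.swap (closure Ksq) (closure Ksq) := by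
    rw [closure_Ksq]
    exact fun z hz => ⟨hz.2, hz.1⟩
  refine integral_mono_of_nonneg (Filter.Eventually.of_forall fun z => sq_nonneg _)
    (integrableOn_Ksq ((hfc.comp continuous_swap.continuousOn hmaps).norm.pow 2)) ?_
  filter_upwards [ae_restrict_mem measurableSet_Ksq] with z hz
  refine pow_le_pow_left₀ (norm_nonneg _) (norm_fderiv_comp_swap_le ?_) 2
  exact (hu.differentiableOn one_ne_zero).differentiableAt
    (hU.mem_nhds (hKU (hmaps (subset_closure hz))))

/-- Approximation of one complex component of a continuously differentiable field. -/
lemma exists_complex_approx {E : Type*} [NormedAddCommGroup E] [NormedSpace ℝ E] {p : ℕ}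
    (hp : 1 ≤ p) {u : ℝ × ℝ → E} {U : Set (ℝ × ℝ)} (hU : IsOpen U) (hKU : closure Ksq ⊆ U)
    (hu : ContDiffOn ℝ 1 u U) (L : E →L[ℝ] ℂ) (hL : ‖L‖ ≤ 1)
    (h0 : ∀ t ∈ Set.Icc (0 : ℝ) 1, L (u (0, t)) = 0 ∧ L (u (1, t)) = 0) :
    ∃ q : ℝ × ℝ → ℂ, IsPoly2 p (p - 1) q ∧ (∀ t, q (0, t) = 0 ∧ q (1, t) = 0) ∧
      p ^ 2 * ∫ z in Ksq, ‖L (u z) - q z‖ ^ 2 ≤ 32 * ∫ z in Ksq, ‖fderiv ℝ u z‖ ^ 2 := by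
  obtain ⟨a, ha, ha0, hae⟩ := exists_component_approx hp hU hKU hu (Complex.reCLM.comp L)
    ((ContinuousLinearMap.opNorm_comp_le _ _).trans (by simpa using hL))
    fun t ht => by simp [h0 t ht]
  obtain ⟨b, hb, hb0, hbe⟩ := exists_component_approx hp hU hKU hu (Complex.imCLM.comp L)
    ((ContinuousLinearMap.opNorm_comp_le _ _).trans (by simpa using hL))
    fun t ht => by simp [h0 t ht]
  have huc : ContinuousOn u (closure Ksq) := hu.continuousOn.mono hKU
  have hac : Continuous a := by
    simpa [Function.comp_def] using Complex.continuous_re.comp ha.continuous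
  have hbc : Continuous b := by
    simpa [Function.comp_def] using Complex.continuous_re.comp hb.continuous
  refine ⟨fun z => a z + Complex.I * b z, ha.add (hb.const_mul _), fun t => ?_, ?_⟩
  · simp [ha0, hb0]
  · have e : ∀ z, ‖L (u z) - (a z + Complex.I * b z)‖ ^ 2 =
        (Complex.reCLM.comp L (u z) - a z) ^ 2 + (Complex.imCLM.comp L (u z) - b z) ^ 2 := by
      intro z
      rw [← Complex.normSq_eq_norm_sq, Complex.normSq_apply]
      simp [sq]
    simp only [e]
    have ia : IntegrableOn (fun z => (Complex.reCLM.comp L (u z) - a z) ^ 2) Ksq :=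
      integrableOn_Ksq ((((ContinuousLinearMap.continuous _).comp_continuousOn huc).sub
        hac.continuousOn).pow 2)
    have ib : IntegrableOn (fun z => (Complex.imCLM.comp L (u z) - b z) ^ 2) Ksq :=
      integrableOn_Ksq ((((ContinuousLinearMap.continuous _).comp_continuousOn huc).sub
        hbc.continuousOn).pow 2)
    rw [integral_add ia ib]
    linarith

/-- Best L²-approximation of C¹ bubble fields by Raviart–Thomas bubbles (case `r = 1`):
`inf_{q ∈ RT_p⁰(K)} ‖u − q‖_{0,K} ≤ C p⁻¹ (‖u‖²_{0,K} + ‖Du‖²_{0,K})^{1/2}`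
with `C` independent of `p` and `u`. -/
theorem best_L2_approx_by_RT_bubbles :
    ∃ C > 0, ∀ p : ℕ, 1 ≤ p → ∀ u : ℝ × ℝ → ℂ × ℂ,
      (∃ U, IsOpen U ∧ closure Ksq ⊆ U ∧ ContDiffOn ℝ 1 u U) →
      (∀ t ∈ Set.Icc (0 : ℝ) 1,
        (u (0, t)).1 = 0 ∧ (u (1, t)).1 = 0 ∧ (u (t, 0)).2 = 0 ∧ (u (t, 1)).2 = 0) →
      sInf { r : ℝ | ∃ q, MemRT0 p q ∧ r = nrm2 (fun x => u x - q x) } ≤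
        C * (p : ℝ)⁻¹ *
          Real.sqrt ((∫ x in Ksq, (‖(u x).1‖ ^ 2 + ‖(u x).2‖ ^ 2)) +
            ∫ x in Ksq, ‖fderiv ℝ u x‖ ^ 2) := by

  refine ⟨8, by norm_num, ?_⟩
  rintro p hp u ⟨U, hU, hKU, hu⟩ hbd
  have hKU' : closure Ksq ⊆ Prod.swap ⁻¹' U := fun z hz => hKU <| by
    rw [closure_Ksq] at hz ⊢
    exact ⟨hz.2, hz.1⟩
  obtain ⟨a, ha, ha0, hae⟩ := exists_complex_approx hp hU hKU hu
    (ContinuousLinearMap.fst ℝ ℂ ℂ) (ContinuousLinearMap.norm_fst_le ..)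
    fun t ht => ⟨(hbd t ht).1, (hbd t ht).2.1⟩
  obtain ⟨b, hb, hb0, hbe⟩ := exists_complex_approx hp (hU.preimage continuous_swap) hKU'
    (u := fun z => u z.swap)
    (hu.comp (contDiff_snd.prodMk contDiff_fst).contDiffOn fun z hz => hz)
    (ContinuousLinearMap.snd ℝ ℂ ℂ) (ContinuousLinearMap.norm_snd_le ..)
    fun t ht => ⟨(hbd t ht).2.2.1, (hbd t ht).2.2.2⟩
  have hbs := integral_fderiv_comp_swap_le hU hKU hu
  have hbe' := setIntegral_Ksq_swap fun z => ‖(u z).2 - b z.swap‖ ^ 2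
  simp only [Prod.swap_swap] at hbe'
  simp only [ContinuousLinearMap.coe_fst', ContinuousLinearMap.coe_snd'] at hae hbe
  rw [hbe'] at hbe
  have huc : ContinuousOn u (closure Ksq) := hu.continuousOn.mono hKU
  have hq : MemRT0 p fun z => (a z, b z.swap) :=
    ⟨⟨ha, hb.comp_swap⟩, fun t _ => ⟨(ha0 t).1, (ha0 t).2, (hb0 t).1, (hb0 t).2⟩⟩
  have hbelow : BddBelow { r : ℝ | ∃ q, MemRT0 p q ∧ r = nrm2 (fun x => u x - q x) } :=
    ⟨0, by rintro r ⟨q, -, rfl⟩; exact Real.sqrt_nonneg _⟩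
  refine (csInf_le hbelow ⟨_, hq, rfl⟩).trans ?_
  have hp0 : (0 : ℝ) < p := by exact_mod_cast hp
  have hN : 0 ≤ ∫ z in Ksq, (‖(u z).1‖ ^ 2 + ‖(u z).2‖ ^ 2) := by positivity
  refine Real.sqrt_le_iff.2 ⟨by positivity, ?_⟩
  rw [mul_pow, Real.sq_sqrt (by positivity), mul_pow, inv_pow, mul_assoc, mul_left_comm,
    le_inv_mul_iff₀ (by positivity)]
  simp only [Prod.fst_sub, Prod.snd_sub]
  have ia : IntegrableOn (fun z => ‖(u z).1 - a z‖ ^ 2) Ksq :=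
    integrableOn_Ksq ((huc.fst.sub ha.continuous.continuousOn).norm.pow 2)
  have ib : IntegrableOn (fun z => ‖(u z).2 - b z.swap‖ ^ 2) Ksq :=
    integrableOn_Ksq
      ((huc.snd.sub (hb.continuous.comp continuous_swap).continuousOn).norm.pow 2)
  rw [integral_add ia ib]
  linarith
end
end
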